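/- In the log–nonconvex economy, fix e^A₁, e^A₂, e^B₂ > 0 and D > 0 and let e^B₁ vary. Then there exists M > 0 such that for every e^B₁ ≥ M: Δ ≥ 0 and e^B₁ + e^B₂·π^int ≥ x*·√D hold; there exists an equilibrium; any two equilibria have the same relative price p₂/p₁ and the same allocation; and this equilibrium satisfies c^B₁ > 0. -/

import Mathlib

/-- The function `g` from the paper (with `g(2) = 1/2 − ln 2` by the same formula). -/
noncomputable def g (x : ℝ) : ℝ :=
  (1/8) * (x + Real.sqrt (x^2 - 4))^2 + Real.log (1 - Real.sqrt (1 - 4/x^2)) - Real.log 2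

/-- Equilibrium of the log–nonconvex economy: agent A has utility `ln c₁ + ln c₂`
(on `c₁, c₂ > 0`), agent B has utility `c₁²/2 + D ln c₂` (on `c₁ ≥ 0, c₂ > 0`),
each maximizes on their budget set, and both markets clear. -/
def LogEquil (DD eA1 eA2 eB1 eB2 p1 p2 : ℝ) (cA cB : ℝ × ℝ) : Prop :=
  0 < p1 ∧ 0 < p2 ∧
  (0 < cA.1 ∧ 0 < cA.2 ∧ p1*cA.1 + p2*cA.2 ≤ p1*eA1 + p2*eA2) ∧
  (∀ c : ℝ × ℝ, 0 < c.1 → 0 < c.2 → p1*c.1 + p2*c.2 ≤ p1*eA1 + p2*eA2 →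
    Real.log c.1 + Real.log c.2 ≤ Real.log cA.1 + Real.log cA.2) ∧
  (0 ≤ cB.1 ∧ 0 < cB.2 ∧ p1*cB.1 + p2*cB.2 ≤ p1*eB1 + p2*eB2) ∧
  (∀ c : ℝ × ℝ, 0 ≤ c.1 → 0 < c.2 → p1*c.1 + p2*c.2 ≤ p1*eB1 + p2*eB2 →
    c.1^2/2 + DD*Real.log c.2 ≤ cB.1^2/2 + DD*Real.log cB.2) ∧
  cA.1 + cB.1 = eA1 + eB1 ∧ cA.2 + cB.2 = eA2 + eB2
/-- `Δ = [(e^B₁+e^A₁)(e^B₂+e^A₂) + e^B₁e^B₂]² − [(e^B₂+e^A₂)² − (e^B₂)²]·[(e^B₁+e^A₁)² + 4D − (e^B₁)²]`. -/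
noncomputable def Delta (DD eA1 eA2 eB1 eB2 : ℝ) : ℝ :=
  ((eB1+eA1)*(eB2+eA2) + eB1*eB2)^2
    - ((eB2+eA2)^2 - eB2^2) * ((eB1+eA1)^2 + 4*DD - eB1^2)

/-- `π^int = ((e^B₁+e^A₁)(e^B₂+e^A₂) + e^B₁e^B₂ − √Δ)/((e^B₂+e^A₂)² − (e^B₂)²)`. -/
noncomputable def piInt (DD eA1 eA2 eB1 eB2 : ℝ) : ℝ :=
  ((eB1+eA1)*(eB2+eA2) + eB1*eB2 - Real.sqrt (Delta DD eA1 eA2 eB1 eB2))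
    / ((eB2+eA2)^2 - eB2^2)

/-- On the budget line, the upper root `r` of `c (W - c) = D` is agent B's strict global optimum
once `9 D ≤ r²`. -/
lemma sq_div_two_add_mul_log_lt {D W r c : ℝ} (hD : 0 < D) (hr : 0 < r)
    (hrW : r * (W - r) = D) (hr9 : 9 * D ≤ r ^ 2) (hc0 : 0 ≤ c) (hcW : c < W) (hcr : c ≠ r) :
    c ^ 2 / 2 + D * Real.log (W - c) < r ^ 2 / 2 + D * Real.log (W - r) := by
  obtain ⟨d, hd⟩ : ∃ d, d = W - r := ⟨_, rfl⟩
  rw [← hd] at hrW ⊢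
  have hd0 : 0 < d := by
    by_contra! h
    nlinarith
  have hd9 : 9 * d ≤ r := by
    by_contra! h
    nlinarith
  obtain ⟨u, hu⟩ : ∃ u, u = Real.sqrt ((W - c) / d) := ⟨_, rfl⟩
  have hz : 0 < (W - c) / d := div_pos (by linarith) hd0
  have hu0 : 0 < u := hu ▸ Real.sqrt_pos.2 hz
  have hWc : W - c = u ^ 2 * d := by
    rw [hu, Real.sq_sqrt hz.le]
    field_simp
  have hlog : Real.log (W - c) = 2 * Real.log u + Real.log d := by
    rw [hWc, Real.log_mul (by positivity) hd0.ne', Real.log_pow]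
    push_cast
    rfl
  have hlogu : Real.log u ≤ u - 1 := Real.log_le_sub_one_of_pos hu0
  have hc : c = r - (u ^ 2 - 1) * d := by linarith
  have hu1 : u ≠ 1 := by
    rintro rfl
    apply hcr
    linarith
  have hsq : 0 < (u - 1) ^ 2 := by
    have := sub_ne_zero.2 hu1
    positivity
  have hkey : (u + 1) ^ 2 * d < 2 * r := by
    rcases le_or_gt u 3 with h | h
    · have : (u + 1) ^ 2 ≤ 16 := by nlinarith
      nlinarith
    · have h1 : (u ^ 2 - 1) * d ≤ r := by linarith
      have h2 : (u - 1) * ((u + 1) ^ 2 * d) ≤ (u + 1) * r := by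
        calc (u - 1) * ((u + 1) ^ 2 * d) = (u + 1) * ((u ^ 2 - 1) * d) := by ring
          _ ≤ (u + 1) * r := by gcongr
      by_contra! h3
      nlinarith
  have hquad : c ^ 2 - r ^ 2 + 4 * D * (u - 1) < 0 := by
    have h1 : c ^ 2 - r ^ 2 + 4 * D * (u - 1) = d * ((u - 1) ^ 2 * ((u + 1) ^ 2 * d - 2 * r)) := by
      rw [hc, ← hrW]
      ring
    rw [h1]
    exact mul_neg_of_pos_of_neg hd0 (mul_neg_of_pos_of_neg hsq (by linarith))
  rw [hlog]
  nlinarith [mul_le_mul_of_nonneg_left hlogu hD.le]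

/-- Agent B's strict optimum over the whole budget set, at prices `(1, p)` and wealth `W`. -/
lemma utilityB_lt {D W r p : ℝ} (hD : 0 < D) (hr : 0 < r) (hp : 0 < p)
    (hrW : r * (W - r) = D) (hr9 : 9 * D ≤ r ^ 2) {c : ℝ × ℝ} (hc1 : 0 ≤ c.1) (hc2 : 0 < c.2)
    (hb : c.1 + p * c.2 ≤ W) (hne : c ≠ (r, (W - r) / p)) :
    c.1 ^ 2 / 2 + D * Real.log c.2 < r ^ 2 / 2 + D * Real.log ((W - r) / p) := by
  have hpc : 0 < p * c.2 := mul_pos hp hc2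
  have hWr : 0 < W - r := by
    by_contra! h
    nlinarith
  have hlogc : Real.log (p * c.2) = Real.log p + Real.log c.2 := Real.log_mul hp.ne' hc2.ne'
  rw [Real.log_div hWr.ne' hp.ne']
  by_cases h : c.1 = r
  · have hlt : p * c.2 < W - r := by
      refine lt_of_le_of_ne (by linarith) fun he => hne (Prod.ext h ?_)
      rw [← he]
      field_simp
    have := mul_lt_mul_of_pos_left (Real.log_lt_log hpc hlt) hD
    rw [h]
    rw [hlogc] at this
    linarith
  · have h1 := sq_div_two_add_mul_log_lt hD hr hrW hr9 hc1 (by linarith : c.1 < W) h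
    have h2 := mul_le_mul_of_nonneg_left
      (Real.log_le_log hpc (by linarith : p * c.2 ≤ W - c.1)) hD.le
    rw [hlogc] at h2
    linarith

/-- Agent A's strict optimum over the budget set, at prices `(1, p)` and wealth `W`. -/
lemma utilityA_lt {W p : ℝ} (hp : 0 < p) {c : ℝ × ℝ} (hc1 : 0 < c.1) (hc2 : 0 < c.2)
    (hb : c.1 + p * c.2 ≤ W) (hne : c ≠ (W / 2, W / (2 * p))) :
    Real.log c.1 + Real.log c.2 < Real.log (W / 2) + Real.log (W / (2 * p)) := by
  have hpc : 0 < p * c.2 := mul_pos hp hc2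
  have hW : 0 < W := by linarith
  rw [← Real.log_mul hc1.ne' hc2.ne', ← Real.log_mul (by positivity) (by positivity)]
  apply Real.log_lt_log (by positivity)
  have hlt : 4 * (c.1 * (p * c.2)) < W ^ 2 := by
    by_cases h : c.1 = p * c.2
    · have : 2 * c.1 < W := by
        refine lt_of_le_of_ne (by linarith) fun he => hne (Prod.ext (by simp; linarith) ?_)
        rw [← he, h]
        field_simp
      rw [← h]
      nlinarith
    · have : 0 < (c.1 - p * c.2) ^ 2 := by
        have := sub_ne_zero.2 h
        positivity
      nlinarith
  rw [div_mul_div_comm, lt_div_iff₀ (by positivity)]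
  linarith

/-- Equilibria are invariant under normalizing the first price to one. -/
lemma LogEquil.normalize {D eA1 eA2 eB1 eB2 p1 p2 : ℝ} {cA cB : ℝ × ℝ}
    (h : LogEquil D eA1 eA2 eB1 eB2 p1 p2 cA cB) :
    LogEquil D eA1 eA2 eB1 eB2 1 (p2 / p1) cA cB := by
  obtain ⟨hp1, hp2, ⟨hA1, hA2, hA⟩, hAo, ⟨hB1, hB2, hB⟩, hBo, hm⟩ := h
  have key (a b e f : ℝ) :
      1 * a + p2 / p1 * b ≤ 1 * e + p2 / p1 * f ↔ p1 * a + p2 * b ≤ p1 * e + p2 * f := by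
    have h1 (x y : ℝ) : p1 * x + p2 * y = p1 * (1 * x + p2 / p1 * y) := by field_simp
    rw [h1 a b, h1 e f, mul_le_mul_iff_right₀ hp1]
  exact ⟨one_pos, div_pos hp2 hp1, ⟨hA1, hA2, (key _ _ _ _).2 hA⟩,
    fun c h1 h2 h3 => hAo c h1 h2 ((key _ _ _ _).1 h3), ⟨hB1, hB2, (key _ _ _ _).2 hB⟩,
    fun c h1 h2 h3 => hBo c h1 h2 ((key _ _ _ _).1 h3), hm⟩

/-- When agent B is rich enough, equilibrium consumption solves the first-order conditions, on the
upper branch for agent B. -/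
lemma LogEquil.foc {D eA1 eA2 eB1 eB2 p : ℝ} {cA cB : ℝ × ℝ}
    (heA1 : 0 < eA1) (heA2 : 0 < eA2) (heB2 : 0 < eB2) (hD : 0 < D)
    (hM : 6 * Real.sqrt D ≤ eB1) (h : LogEquil D eA1 eA2 eB1 eB2 1 p cA cB) :
    cA = ((eA1 + p * eA2) / 2, (eA1 + p * eA2) / (2 * p)) ∧
    cB.1 * (eB1 + p * eB2 - cB.1) = D ∧ cB.2 = (eB1 + p * eB2 - cB.1) / p ∧
    0 < cB.1 ∧ eB1 + p * eB2 ≤ 2 * cB.1 := by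
  obtain ⟨-, hp, ⟨hA1, hA2, hA⟩, hAo, ⟨hB1, hB2, hB⟩, hBo, -⟩ := h
  simp only [one_mul] at *
  have hs : 0 < Real.sqrt D := Real.sqrt_pos.2 hD
  have hs2 : Real.sqrt D ^ 2 = D := Real.sq_sqrt hD.le
  obtain ⟨V, hV⟩ : ∃ V, V = eA1 + p * eA2 := ⟨_, rfl⟩
  obtain ⟨W, hW⟩ : ∃ W, W = eB1 + p * eB2 := ⟨_, rfl⟩
  have hV0 : 0 < V := by rw [hV]; positivity
  have hW6 : 6 * Real.sqrt D ≤ W := by rw [hW]; nlinarith [mul_pos hp heB2]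
  rw [← hV] at hA hAo ⊢
  rw [← hW] at hB hBo ⊢
  have hdisc : 0 ≤ W ^ 2 - 4 * D := by nlinarith
  obtain ⟨t, ht⟩ : ∃ t, t = Real.sqrt (W ^ 2 - 4 * D) := ⟨_, rfl⟩
  have ht0 : 0 ≤ t := ht ▸ Real.sqrt_nonneg _
  have ht2 : t ^ 2 = W ^ 2 - 4 * D := by rw [ht, Real.sq_sqrt hdisc]
  obtain ⟨r, hr⟩ : ∃ r, r = (W + t) / 2 := ⟨_, rfl⟩
  have hr3 : 3 * Real.sqrt D ≤ r := by linarith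
  have hr0 : 0 < r := by linarith
  have hrW : r * (W - r) = D := by rw [hr]; nlinarith
  have hr9 : 9 * D ≤ r ^ 2 := by nlinarith
  have hWr : 0 < W - r := by
    by_contra! h
    nlinarith
  have hcA : cA = (V / 2, V / (2 * p)) := by
    by_contra hne
    refine (utilityA_lt hp hA1 hA2 hA hne).not_ge ?_
    exact hAo (V / 2, V / (2 * p)) (by positivity) (by positivity)
      (le_of_eq (by field_simp; ring))
  have hcB : cB = (r, (W - r) / p) := by
    by_contra hne
    refine (utilityB_lt hD hr0 hp hrW hr9 hB1 hB2 hB hne).not_ge ?_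
    exact hBo (r, (W - r) / p) hr0.le (div_pos hWr hp) (le_of_eq (by field_simp; ring))
  subst hcB
  exact ⟨hcA, hrW, rfl, hr0, by dsimp only; linarith⟩

/-- Market clearing together with B's first-order condition on the upper branch determines the
price: both agents' demands for good 1 increase in the relative price of good 2. -/
lemma price_le_of_foc {D eA1 eA2 eB1 eB2 p q r s : ℝ} (heA2 : 0 < eA2) (heB2 : 0 < eB2)
    (hp : (eA1 + p * eA2) / 2 + r = eA1 + eB1) (hq : (eA1 + q * eA2) / 2 + s = eA1 + eB1)
    (hr : r * (eB1 + p * eB2 - r) = D) (hs : s * (eB1 + q * eB2 - s) = D) (hs0 : 0 < s)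
    (hs2 : eB1 + q * eB2 ≤ 2 * s) : q ≤ p := by
  by_contra! h
  have h1 : s < r := by nlinarith [mul_lt_mul_of_pos_right h heA2]
  have h2 : p * eB2 < q * eB2 := mul_lt_mul_of_pos_right h heB2
  have h3 : s * (eB1 + p * eB2 - s) < D := by
    rw [← hs]
    exact mul_lt_mul_of_pos_left (by linarith) hs0
  nlinarith [mul_nonneg (sub_nonneg.2 h1.le) (by linarith : 0 ≤ r + s - (eB1 + p * eB2))]

/-- Equilibrium allocations and relative prices are unique once agent B is rich enough. -/
lemma LogEquil.unique {D eA1 eA2 eB1 eB2 p q : ℝ} {cA cB dA dB : ℝ × ℝ}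
    (heA1 : 0 < eA1) (heA2 : 0 < eA2) (heB2 : 0 < eB2) (hD : 0 < D)
    (hM : 6 * Real.sqrt D ≤ eB1) (h : LogEquil D eA1 eA2 eB1 eB2 1 p cA cB)
    (h' : LogEquil D eA1 eA2 eB1 eB2 1 q dA dB) : p = q ∧ cA = dA ∧ cB = dB := by
  obtain ⟨rfl, hr, hc2, hr0, hr2⟩ := h.foc heA1 heA2 heB2 hD hM
  obtain ⟨rfl, hs, hd2, hs0, hs2⟩ := h'.foc heA1 heA2 heB2 hD hM
  obtain ⟨-, -, -, -, -, -, hp, -⟩ := h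
  obtain ⟨-, -, -, -, -, -, hq, -⟩ := h'
  obtain rfl : p = q := le_antisymm
    (price_le_of_foc heA2 heB2 hq hp hs hr hr0 hr2)
    (price_le_of_foc heA2 heB2 hp hq hr hs hs0 hs2)
  have h1 : cB.1 = dB.1 := by linarith
  exact ⟨rfl, rfl, Prod.ext h1 (by rw [hc2, hd2, h1])⟩

/-- A price solving the market-clearing first-order condition on the upper branch supports an
equilibrium. -/
lemma exists_logEquil_of_foc {D eA1 eA2 eB1 eB2 p r : ℝ}
    (heA1 : 0 < eA1) (heA2 : 0 < eA2) (heB2 : 0 < eB2) (hD : 0 < D)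
    (hM : 6 * Real.sqrt D ≤ eB1) (hp : 0 < p)
    (hm : (eA1 + p * eA2) / 2 + r = eA1 + eB1) (hr : r * (eB1 + p * eB2 - r) = D)
    (hr2 : eB1 + p * eB2 ≤ 2 * r) :
    ∃ cA cB : ℝ × ℝ, LogEquil D eA1 eA2 eB1 eB2 1 p cA cB := by
  have hs : 0 < Real.sqrt D := Real.sqrt_pos.2 hD
  have hs2 : Real.sqrt D ^ 2 = D := Real.sq_sqrt hD.le
  have hpB : 0 < p * eB2 := mul_pos hp heB2
  have hr3 : 3 * Real.sqrt D ≤ r := by linarith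
  have hr0 : 0 < r := by linarith
  have hr9 : 9 * D ≤ r ^ 2 := by nlinarith
  have hWr : 0 < eB1 + p * eB2 - r := by
    by_contra! h
    nlinarith
  refine ⟨((eA1 + p * eA2) / 2, (eA1 + p * eA2) / (2 * p)), (r, (eB1 + p * eB2 - r) / p),
    one_pos, hp, ⟨by positivity, by positivity, le_of_eq (by field_simp; ring)⟩, ?_,
    ⟨hr0.le, div_pos hWr hp, le_of_eq (by field_simp; ring)⟩, ?_, hm, ?_⟩
  · intro c h1 h2 h3
    simp only [one_mul] at h3
    by_cases hne : c = ((eA1 + p * eA2) / 2, (eA1 + p * eA2) / (2 * p))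
    · rw [hne]
    · exact (utilityA_lt hp h1 h2 h3 hne).le
  · intro c h1 h2 h3
    simp only [one_mul] at h3
    by_cases hne : c = (r, (eB1 + p * eB2 - r) / p)
    · rw [hne]
    · exact (utilityB_lt hD hr0 hp hr hr9 h1 h2 h3 hne).le
  · dsimp only
    have : r = eA1 + eB1 - (eA1 + p * eA2) / 2 := by linarith
    rw [this]
    field_simp
    ring

/-- The interior candidate price is positive, solves the clearing quadratic and lies weakly below
its vertex. -/
lemma piInt_spec {D eA1 eA2 eB1 eB2 : ℝ} (heA1 : 0 < eA1) (heA2 : 0 < eA2) (heB1 : 0 < eB1)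
    (heB2 : 0 < eB2) (hD : 0 < D) (hΔ : 0 ≤ Delta D eA1 eA2 eB1 eB2) :
    0 < piInt D eA1 eA2 eB1 eB2 ∧
    (2 * eB1 + eA1 - piInt D eA1 eA2 eB1 eB2 * eA2) *
      (piInt D eA1 eA2 eB1 eB2 * (2 * eB2 + eA2) - eA1) = 4 * D ∧
    ((eB2 + eA2) ^ 2 - eB2 ^ 2) * piInt D eA1 eA2 eB1 eB2 ≤
      (eB1 + eA1) * (eB2 + eA2) + eB1 * eB2 := by
  obtain ⟨p, hp⟩ : ∃ p, p = piInt D eA1 eA2 eB1 eB2 := ⟨_, rfl⟩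
  obtain ⟨t, ht⟩ : ∃ t, t = Real.sqrt (Delta D eA1 eA2 eB1 eB2) := ⟨_, rfl⟩
  have ht0 : 0 ≤ t := ht ▸ Real.sqrt_nonneg _
  have ht2 : t ^ 2 = Delta D eA1 eA2 eB1 eB2 := by rw [ht, Real.sq_sqrt hΔ]
  obtain ⟨n, hn⟩ : ∃ n, n = (eB1 + eA1) * (eB2 + eA2) + eB1 * eB2 := ⟨_, rfl⟩
  obtain ⟨d, hd⟩ : ∃ d, d = (eB2 + eA2) ^ 2 - eB2 ^ 2 := ⟨_, rfl⟩
  obtain ⟨k, hk⟩ : ∃ k, k = (eB1 + eA1) ^ 2 + 4 * D - eB1 ^ 2 := ⟨_, rfl⟩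
  have hn0 : 0 < n := by rw [hn]; positivity
  have hd0 : 0 < d := by
    have : d = eA2 * (2 * eB2 + eA2) := by rw [hd]; ring
    rw [this]; positivity
  have hk0 : 0 < k := by
    have : k = eA1 * (2 * eB1 + eA1) + 4 * D := by rw [hk]; ring
    rw [this]; positivity
  rw [Delta, ← hn, ← hd, ← hk] at ht2
  have hdp : d * p = n - t := by
    rw [hp, piInt, ← hn, ← hd, ← ht]
    field_simp
  have htn : t < n := by
    by_contra! h
    nlinarith [mul_pos hd0 hk0]
  have hquad : d * p ^ 2 - 2 * n * p + k = 0 := by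
    have : d * (d * p ^ 2 - 2 * n * p + k) = 0 := by
      linear_combination (d * p + (n - t) - 2 * n) * hdp + ht2
    exact (mul_eq_zero.1 this).resolve_left hd0.ne'
  rw [← hp, ← hn, ← hd]
  refine ⟨?_, ?_, by linarith⟩
  · by_contra! h
    nlinarith
  · rw [hn, hd, hk] at hquad
    linear_combination -hquad

/-- At the interior candidate price, agent B's implied demand lies on the upper branch. -/
lemma piInt_upper_branch {D eA1 eA2 eB1 eB2 p : ℝ} (heA1 : 0 < eA1) (heA2 : 0 < eA2)
    (heB1 : 0 < eB1) (heB2 : 0 < eB2) (h4D : 4 * D < eB1 ^ 2)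
    (hquad : (2 * eB1 + eA1 - p * eA2) * (p * (2 * eB2 + eA2) - eA1) = 4 * D)
    (hvertex : ((eB2 + eA2) ^ 2 - eB2 ^ 2) * p ≤ (eB1 + eA1) * (eB2 + eA2) + eB1 * eB2) :
    p * (eB2 + eA2) ≤ eB1 + eA1 := by
  by_contra! h
  obtain ⟨x, hx⟩ : ∃ x, x = (eB1 + eA1) / (eB2 + eA2) := ⟨_, rfl⟩
  have hxT : x * (eB2 + eA2) = eB1 + eA1 := by rw [hx]; field_simp
  have hx0 : 0 < x := by rw [hx]; positivity
  have hxp : x < p := by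
    rw [← hxT] at h
    exact lt_of_mul_lt_mul_right h (by positivity)
  have hd0 : 0 < (eB2 + eA2) ^ 2 - eB2 ^ 2 := by nlinarith
  have hW : (2 * eB1 + eA1 - x * eA2) * (x * (2 * eB2 + eA2) - eA1) = (eB1 + x * eB2) ^ 2 := by
    have h1 : eA1 = x * (eB2 + eA2) - eB1 := by linarith
    rw [h1]; ring
  have hbig : eB1 ^ 2 < (eB1 + x * eB2) ^ 2 := by
    have := mul_pos hx0 heB2
    nlinarith
  have hdiff : 0 ≤ (p - x) * (2 * ((eB1 + eA1) * (eB2 + eA2) + eB1 * eB2)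
      - ((eB2 + eA2) ^ 2 - eB2 ^ 2) * (p + x)) := by
    refine mul_nonneg (by linarith) ?_
    have := mul_lt_mul_of_pos_left hxp hd0
    linarith
  linarith

/-- `Δ` is nonnegative once `e^B₁` dominates `e^A₁` and `√D`. -/
lemma Delta_nonneg {D eA1 eA2 eB1 eB2 : ℝ} (heA1 : 0 < eA1) (heA2 : 0 < eA2) (heB2 : 0 < eB2)
    (hA : 4 * eA1 ≤ eB1) (h36 : 36 * D ≤ eB1 ^ 2) : 0 ≤ Delta D eA1 eA2 eB1 eB2 := by
  have heB1 : 0 < eB1 := by linarith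
  obtain ⟨S, hS⟩ : ∃ S, S = 2 * eB2 + eA2 := ⟨_, rfl⟩
  have hS0 : 0 < S := by rw [hS]; positivity
  have hn : eB1 * S ≤ (eB1 + eA1) * (eB2 + eA2) + eB1 * eB2 := by
    rw [hS]
    nlinarith [mul_pos heA1 heB2, mul_pos heA1 heA2]
  have hn2 : (eB1 * S) ^ 2 ≤ ((eB1 + eA1) * (eB2 + eA2) + eB1 * eB2) ^ 2 := by gcongr
  have hk : (eB1 + eA1) ^ 2 + 4 * D - eB1 ^ 2 ≤ eB1 ^ 2 := by nlinarith
  have hd : (eB2 + eA2) ^ 2 - eB2 ^ 2 = eA2 * S := by rw [hS]; ring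
  have h1 : eA2 * S * ((eB1 + eA1) ^ 2 + 4 * D - eB1 ^ 2) ≤ S * S * eB1 ^ 2 :=
    calc _ ≤ eA2 * S * eB1 ^ 2 := by gcongr
      _ ≤ S * S * eB1 ^ 2 := by gcongr; linarith
  rw [Delta, hd]
  nlinarith

/-- fixing `e^A₁, e^A₂, e^B₂, D`, for all large enough `e^B₁`: `Δ ≥ 0` and
`e^B₁ + e^B₂ π^int ≥ x* √D` hold, an equilibrium exists, is unique (same relative price
and allocation), and satisfies `c^B₁ > 0`. -/
theorem equilibrium_large_eB1 (DD eA1 eA2 eB2 xs : ℝ)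
    (heA1 : 0 < eA1) (heA2 : 0 < eA2) (heB2 : 0 < eB2) (hD : 0 < DD)
    (hxs2 : 2 < xs) (hxs0 : g xs = 0) :
    ∃ M : ℝ, 0 < M ∧ ∀ eB1 : ℝ, M ≤ eB1 →
      (0 ≤ Delta DD eA1 eA2 eB1 eB2 ∧
        xs * Real.sqrt DD ≤ eB1 + eB2 * piInt DD eA1 eA2 eB1 eB2) ∧
      (∃ p1 p2 : ℝ, ∃ cA cB : ℝ × ℝ, LogEquil DD eA1 eA2 eB1 eB2 p1 p2 cA cB) ∧
      (∀ p1 p2 q1 q2 : ℝ, ∀ cA cB dA dB : ℝ × ℝ,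
        LogEquil DD eA1 eA2 eB1 eB2 p1 p2 cA cB →
        LogEquil DD eA1 eA2 eB1 eB2 q1 q2 dA dB →
        p2/p1 = q2/q1 ∧ cA = dA ∧ cB = dB) ∧
      (∀ p1 p2 : ℝ, ∀ cA cB : ℝ × ℝ,
        LogEquil DD eA1 eA2 eB1 eB2 p1 p2 cA cB → 0 < cB.1) := by
  have hs : 0 < Real.sqrt DD := Real.sqrt_pos.2 hD
  have hs2 : Real.sqrt DD ^ 2 = DD := Real.sq_sqrt hD.le
  have hxsD : 0 < xs * Real.sqrt DD := mul_pos (by linarith) hs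
  refine ⟨xs * Real.sqrt DD + 6 * Real.sqrt DD + 4 * eA1, by positivity, fun eB1 hM => ?_⟩
  have h6 : 6 * Real.sqrt DD ≤ eB1 := by linarith
  have heB1 : 0 < eB1 := by linarith
  have h36 : 36 * DD ≤ eB1 ^ 2 := by nlinarith
  have hΔ := Delta_nonneg heA1 heA2 heB2 (by linarith) h36
  obtain ⟨hp, hquad, hvertex⟩ := piInt_spec heA1 heA2 heB1 heB2 hD hΔ
  have hbranch := piInt_upper_branch heA1 heA2 heB1 heB2 (by linarith) hquad hvertex
  refine ⟨⟨hΔ, by nlinarith [mul_pos heB2 hp]⟩, ?_, ?_, ?_⟩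
  · exact ⟨1, _, exists_logEquil_of_foc
      (r := eA1 + eB1 - (eA1 + piInt DD eA1 eA2 eB1 eB2 * eA2) / 2)
      heA1 heA2 heB2 hD h6 hp (by ring) (by linear_combination hquad / 4) (by linarith)⟩
  · intro p1 p2 q1 q2 cA cB dA dB h h'
    exact h.normalize.unique heA1 heA2 heB2 hD h6 h'.normalize
  · intro p1 p2 cA cB h
    exact (h.normalize.foc heA1 heA2 heB2 hD h6).2.2.2.1
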